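/- Let (g, ω) be a three-step nilpotent symplectic Lie algebra over a field of characteristic 0 (i.e. C³g = [g,[g,[g,g]]] = 0) of dimension at most eight. Then (g, ω) admits a Lagrangian ideal a which contains C²g = [g, [g, g]]. -/

import Mathlib

section SymplecticLieAlgebra

open Module Submodule

section LinearAlgebra

variable {k V : Type*} [Field k] [AddCommGroup V] [Module k V]

theorem exists_add_smul_of_mem_sup_span_singleton {S : Submodule k V} {x u : V}
    (hu : u ∈ S ⊔ span k {x}) : ∃ s ∈ S, ∃ a : k, s + a • x = u := by
  obtain ⟨s, hs, t, ht, rfl⟩ := mem_sup.1 hu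
  obtain ⟨a, rfl⟩ := mem_span_singleton.1 ht
  exact ⟨s, hs, a, rfl⟩

variable [FiniteDimensional k V]

theorem exists_mem_notMem_of_finrank_lt {S T : Submodule k V}
    (h : finrank k S < finrank k T) : ∃ x ∈ T, x ∉ S := by
  by_contra! hTS
  exact absurd (finrank_mono hTS) (by omega)

theorem exists_mem_notMem_apply_eq_zero {S T : Submodule k V} (f : V →ₗ[k] k)
    (h : finrank k S + 2 ≤ finrank k T) : ∃ x ∈ T, x ∉ S ∧ f x = 0 := by
  obtain ⟨x, hx, hxS⟩ := exists_mem_notMem_of_finrank_lt (S := S) (T := T) (by omega)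
  by_cases hfx : f x = 0
  · exact ⟨x, hx, hxS, hfx⟩
  have hf := finrank_sup_span_singleton hxS
  obtain ⟨z, hz, hzS⟩ :=
    exists_mem_notMem_of_finrank_lt (S := S ⊔ span k {x}) (T := T) (by omega)
  refine ⟨z - (f z / f x) • x, T.sub_mem hz (T.smul_mem _ hx), fun hmem ↦ hzS ?_, ?_⟩
  · rw [← sub_add_cancel z ((f z / f x) • x)]
    exact add_mem (mem_sup_left hmem)
      (mem_sup_right (smul_mem _ _ (mem_span_singleton_self x)))
  · simp [hfx]

end LinearAlgebra

section Isotropic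

variable {k V : Type*} [Field k] [AddCommGroup V] [Module k V] {ω : V →ₗ[k] V →ₗ[k] k}

/-- A subspace on which the bilinear form `ω` vanishes identically. -/
def IsIsotropicSubspace (ω : V →ₗ[k] V →ₗ[k] k) (S : Submodule k V) : Prop :=
  ∀ x ∈ S, ∀ y ∈ S, ω x y = 0

theorem apply_swap_of_alternating (halt : ∀ u, ω u u = 0) (u v : V) : ω u v = -ω v u := by
  have h := halt (u + v)
  simp only [map_add, LinearMap.add_apply, halt, zero_add, add_zero] at h
  exact eq_neg_of_add_eq_zero_right h

theorem IsIsotropicSubspace.sup_span_singleton (halt : ∀ u, ω u u = 0) {S : Submodule k V}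
    (hS : IsIsotropicSubspace ω S) {x : V} (hx : ∀ y ∈ S, ω y x = 0) :
    IsIsotropicSubspace ω (S ⊔ span k {x}) := by
  intro u hu v hv
  obtain ⟨s, hs, a, rfl⟩ := exists_add_smul_of_mem_sup_span_singleton hu
  obtain ⟨t, ht, b, rfl⟩ := exists_add_smul_of_mem_sup_span_singleton hv
  have h1 : ω x t = 0 := by rw [apply_swap_of_alternating halt, hx t ht, neg_zero]
  simp [hS s hs t ht, hx s hs, h1, halt]

variable [FiniteDimensional k V]

theorem finrank_add_finrank_orthogonalBilin (halt : ∀ u, ω u u = 0)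
    (hnondeg : ∀ u, (∀ v, ω u v = 0) → u = 0) (S : Submodule k V) :
    finrank k S + finrank k (S.orthogonalBilin ω) = finrank k V := by
  have hnd : LinearMap.Nondegenerate ω := by
    refine ⟨hnondeg, fun u hu ↦ hnondeg u fun v ↦ ?_⟩
    rw [apply_swap_of_alternating halt, hu, neg_zero]
  have h := LinearMap.BilinForm.finrank_orthogonal (B := ω) hnd S
  have h' := finrank_le S
  change finrank k (S.orthogonalBilin ω) = _ at h
  omega

theorem IsIsotropicSubspace.two_mul_finrank_le (halt : ∀ u, ω u u = 0)
    (hnondeg : ∀ u, (∀ v, ω u v = 0) → u = 0) {S : Submodule k V}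
    (hS : IsIsotropicSubspace ω S) : 2 * finrank k S ≤ finrank k V := by
  have h := finrank_add_finrank_orthogonalBilin halt hnondeg S
  have h' : finrank k S ≤ finrank k (S.orthogonalBilin ω) :=
    finrank_mono fun x hx y hy ↦ hS y hy x hx
  omega

/-- Every isotropic subspace is contained in a Lagrangian one. -/
theorem IsIsotropicSubspace.exists_lagrangian (halt : ∀ u, ω u u = 0)
    (hnondeg : ∀ u, (∀ v, ω u v = 0) → u = 0) {S : Submodule k V}
    (hS : IsIsotropicSubspace ω S) :
    ∃ L, S ≤ L ∧ IsIsotropicSubspace ω L ∧ 2 * finrank k L = finrank k V := by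
  induction hd : finrank k V - finrank k S using Nat.strong_induction_on generalizing S with
  | _ d ih =>
    by_cases h2 : 2 * finrank k S = finrank k V
    · exact ⟨S, le_rfl, hS, h2⟩
    have hle := hS.two_mul_finrank_le halt hnondeg
    have hp := finrank_add_finrank_orthogonalBilin halt hnondeg S
    obtain ⟨x, hx, hxS⟩ :=
      exists_mem_notMem_of_finrank_lt (S := S) (T := S.orthogonalBilin ω) (by omega)
    have hf := finrank_sup_span_singleton hxS
    obtain ⟨L, hL, hL', hL''⟩ := ih _ (by omega) (hS.sup_span_singleton halt hx) rfl
    exact ⟨L, le_sup_left.trans hL, hL', hL''⟩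

end Isotropic

variable {k g : Type*} [Field k] [LieRing g] [LieAlgebra k g] {ω : g →ₗ[k] g →ₗ[k] k}

/-- An isotropic ideal (as a plain subspace) containing the given subspace `C`. -/
structure IsIsotropicIdealOver (ω : g →ₗ[k] g →ₗ[k] k) (C S : Submodule k g) : Prop where
  le : C ≤ S
  isotropic : IsIsotropicSubspace ω S
  lie_mem : ∀ x : g, ∀ y ∈ S, ⁅x, y⁆ ∈ S

theorem IsIsotropicIdealOver.sup_span_singleton (halt : ∀ u, ω u u = 0) {C S : Submodule k g}
    (hS : IsIsotropicIdealOver ω C S) {x : g} (hx : ∀ y ∈ S, ω y x = 0)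
    (hlie : ∀ u : g, ⁅u, x⁆ ∈ S) : IsIsotropicIdealOver ω C (S ⊔ span k {x}) where
  le := hS.le.trans le_sup_left
  isotropic := hS.isotropic.sup_span_singleton halt hx
  lie_mem u v hv := by
    obtain ⟨s, hs, a, rfl⟩ := exists_add_smul_of_mem_sup_span_singleton hv
    rw [lie_add, lie_smul]
    exact mem_sup_left (S.add_mem (hS.lie_mem u s hs) (S.smul_mem a (hlie u)))

/-- The terms `C₁ = [g, g]` and `C₂ = [g, C₁]` of the descending central series of a
three-step nilpotent Lie algebra, as plain subspaces. -/
structure IsThreeStepSeries (C₁ C₂ : Submodule k g) : Prop where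
  le : C₂ ≤ C₁
  lie_mem_one : ∀ x y : g, ⁅x, y⁆ ∈ C₁
  one_le : ∀ P : Submodule k g, (∀ x y : g, ⁅x, y⁆ ∈ P) → C₁ ≤ P
  lie_mem_two : ∀ x : g, ∀ y ∈ C₁, ⁅x, y⁆ ∈ C₂
  lie_eq_zero : ∀ x : g, ∀ y ∈ C₂, ⁅x, y⁆ = 0

namespace IsThreeStepSeries

variable {C₁ C₂ : Submodule k g}

theorem apply_one_two (hC : IsThreeStepSeries C₁ C₂)
    (hclosed : ∀ u v w : g, ω ⁅u, v⁆ w + ω ⁅w, u⁆ v + ω ⁅v, w⁆ u = 0)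
    {y z : g} (hy : y ∈ C₁) (hz : z ∈ C₂) : ω y z = 0 := by
  refine hC.one_le (LinearMap.ker (ω.flip z)) (fun u v ↦ ?_) hy
  have h := hclosed u v z
  rw [← lie_skew z u, hC.lie_eq_zero u z hz, hC.lie_eq_zero v z hz] at h
  simpa using h

theorem apply_two_one (hC : IsThreeStepSeries C₁ C₂) (halt : ∀ u, ω u u = 0)
    (hclosed : ∀ u v w : g, ω ⁅u, v⁆ w + ω ⁅w, u⁆ v + ω ⁅v, w⁆ u = 0)
    {y z : g} (hz : z ∈ C₂) (hy : y ∈ C₁) : ω z y = 0 := by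
  rw [apply_swap_of_alternating halt, hC.apply_one_two hclosed hy hz, neg_zero]

/-- Brackets of elements of `C₂^⊥` are orthogonal to `C₁`. -/
theorem apply_lie_of_mem_orthogonal (hC : IsThreeStepSeries C₁ C₂)
    (hclosed : ∀ u v w : g, ω ⁅u, v⁆ w + ω ⁅w, u⁆ v + ω ⁅v, w⁆ u = 0)
    {u w y : g} (hu : u ∈ C₂.orthogonalBilin ω) (hw : w ∈ C₂.orthogonalBilin ω)
    (hy : y ∈ C₁) : ω ⁅u, w⁆ y = 0 := by
  have h := hclosed u w y
  have h1 : ω ⁅y, u⁆ w = 0 := by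
    rw [← lie_skew y u]
    exact hw _ (C₂.neg_mem (hC.lie_mem_two u y hy))
  rw [h1, hu _ (hC.lie_mem_two w y hy)] at h
  simpa using h

theorem apply_lie_lie_eq_zero [CharZero k] (hC : IsThreeStepSeries C₁ C₂)
    (halt : ∀ u, ω u u = 0)
    (hclosed : ∀ u v w : g, ω ⁅u, v⁆ w + ω ⁅w, u⁆ v + ω ⁅v, w⁆ u = 0)
    {v w : g} (hv : v ∈ C₂.orthogonalBilin ω) (hw : w ∈ C₂.orthogonalBilin ω)
    (hvw : ⁅v, w⁆ ∈ C₂) (e : g) : ω ⁅e, v⁆ ⁅e, w⁆ = 0 := by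
  have key : ∀ a ∈ C₂.orthogonalBilin ω, ∀ y ∈ C₁, ω ⁅a, y⁆ e = ω ⁅e, a⁆ y * -1 := by
    intro a ha y hy
    have h := hclosed a y e
    have h1 : ω ⁅y, e⁆ a = 0 := by
      rw [← lie_skew y e]
      exact ha _ (C₂.neg_mem (hC.lie_mem_two e y hy))
    rw [h1] at h
    linear_combination h
  have hJ := congrArg (fun t ↦ ω t e) (leibniz_lie e v w)
  simp only [hC.lie_eq_zero e _ hvw, map_zero, LinearMap.zero_apply, map_add,
    LinearMap.add_apply] at hJ
  rw [← lie_skew ⁅e, v⁆ w, map_neg, LinearMap.neg_apply, key w hw _ (hC.lie_mem_one e v),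
    key v hv _ (hC.lie_mem_one e w), apply_swap_of_alternating halt ⁅e, w⁆] at hJ
  have h2 : (2 : k) * ω ⁅e, v⁆ ⁅e, w⁆ = 0 := by linear_combination hJ
  simpa using h2

/-- Orthogonal elements of `C₁` may be adjoined to an isotropic ideal containing `C₂`. -/
theorem sup_span_singleton (hC : IsThreeStepSeries C₁ C₂) (halt : ∀ u, ω u u = 0)
    {S : Submodule k g} (hS : IsIsotropicIdealOver ω C₂ S) {y : g} (hy : y ∈ C₁)
    (hSy : ∀ s ∈ S, ω s y = 0) : IsIsotropicIdealOver ω C₂ (S ⊔ span k {y}) :=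
  hS.sup_span_singleton halt hSy fun u ↦ hS.le (hC.lie_mem_two u y hy)

theorem isIsotropicIdealOver_self (hC : IsThreeStepSeries C₁ C₂)
    (hclosed : ∀ u v w : g, ω ⁅u, v⁆ w + ω ⁅w, u⁆ v + ω ⁅v, w⁆ u = 0) :
    IsIsotropicIdealOver ω C₂ C₂ where
  le := le_rfl
  isotropic _ hx _ hy := hC.apply_one_two hclosed (hC.le hx) hy
  lie_mem x y hy := by rw [hC.lie_eq_zero x y hy]; exact C₂.zero_mem

theorem exists_mem_one_notMem (hiso : ¬IsIsotropicSubspace ω C₁) {S : Submodule k g}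
    (hS : IsIsotropicIdealOver ω C₂ S) : ∃ y ∈ C₁, y ∉ S := by
  by_contra! h
  exact hiso fun x hx y hy ↦ hS.isotropic x (h x hx) y (h y hy)

/-- If isotropic ideals over a one-dimensional `C₂` have dimension at most three, and none of
them is Lagrangian, then `C₁` is isotropic. -/
theorem isIsotropicSubspace_of_finrank_eq_one [CharZero k] [FiniteDimensional k g]
    (hC : IsThreeStepSeries C₁ C₂)
    (halt : ∀ u, ω u u = 0) (hnondeg : ∀ u, (∀ v, ω u v = 0) → u = 0)
    (hclosed : ∀ u v w : g, ω ⁅u, v⁆ w + ω ⁅w, u⁆ v + ω ⁅v, w⁆ u = 0)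
    (hmax : ∀ S, IsIsotropicIdealOver ω C₂ S → finrank k S ≤ 3)
    (hdim : ∀ S, IsIsotropicIdealOver ω C₂ S → 2 * finrank k S + 2 ≤ finrank k g)
    (hrank : finrank k C₂ = 1) : IsIsotropicSubspace ω C₁ := by
  by_contra hiso
  have hC₂ := hC.isIsotropicIdealOver_self hclosed
  have hU := finrank_add_finrank_orthogonalBilin halt hnondeg C₂
  obtain ⟨e, -, he⟩ := exists_mem_notMem_of_finrank_lt
    (S := C₂.orthogonalBilin ω) (T := ⊤) (by rw [finrank_top]; omega)
  have htop : C₂.orthogonalBilin ω ⊔ span k {e} = ⊤ := by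
    apply eq_top_of_finrank_eq
    rw [finrank_sup_span_singleton he]
    omega
  have hdec : ∀ x : g, ∃ u ∈ C₂.orthogonalBilin ω, ∃ a : k, u + a • e = x := fun x ↦
    exists_add_smul_of_mem_sup_span_singleton (htop ▸ mem_top)
  obtain ⟨u, hu, w, hw, huw⟩ : ∃ u ∈ C₂.orthogonalBilin ω, ∃ w ∈ C₂.orthogonalBilin ω,
      ⁅u, w⁆ ∉ C₂ := by
    by_contra! h
    have hle : C₁ ≤ C₂ ⊔ (C₂.orthogonalBilin ω).map (LieAlgebra.ad k g e) := by
      refine hC.one_le _ fun x y ↦ ?_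
      obtain ⟨u, hu, a, rfl⟩ := hdec x
      obtain ⟨w, hw, b, rfl⟩ := hdec y
      have hxy : ⁅u + a • e, w + b • e⁆ = ⁅u, w⁆ + ⁅e, a • w - b • u⁆ := by
        rw [lie_sub, lie_smul, lie_smul, ← lie_skew e u, add_lie, lie_add, lie_add, smul_lie,
          smul_lie, lie_smul, lie_smul, lie_self, smul_zero, smul_zero, smul_neg]
        abel
      rw [hxy]
      exact add_mem (mem_sup_left (h u hu w hw)) (mem_sup_right
        ⟨_, sub_mem (smul_mem _ _ hw) (smul_mem _ _ hu), rfl⟩)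
    refine hiso fun x hx y hy ↦ ?_
    obtain ⟨z, hz, _, ⟨v, hv, rfl⟩, rfl⟩ := mem_sup.1 (hle hx)
    obtain ⟨z', hz', _, ⟨v', hv', rfl⟩, rfl⟩ := mem_sup.1 (hle hy)
    simp [hC.apply_one_two hclosed (hC.le hz) hz',
      hC.apply_two_one halt hclosed hz (hC.lie_mem_one e v'),
      hC.apply_one_two hclosed (hC.lie_mem_one e v) hz',
      hC.apply_lie_lie_eq_zero halt hclosed hv hv' (h v hv v' hv') e]
  have hq : ∀ y ∈ C₁, ω ⁅u, w⁆ y = 0 := fun y ↦ hC.apply_lie_of_mem_orthogonal hclosed hu hw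
  have hN := hC.sup_span_singleton halt hC₂ (hC.lie_mem_one u w) fun s hs ↦
    hC.apply_two_one halt hclosed hs (hC.lie_mem_one u w)
  have hNrank := finrank_sup_span_singleton huw
  have hNperp : ∀ s ∈ C₂ ⊔ span k {⁅u, w⁆}, ∀ y ∈ C₁, ω s y = 0 := by
    intro s hs y hy
    obtain ⟨z, hz, a, rfl⟩ := exists_add_smul_of_mem_sup_span_singleton hs
    simp [hC.apply_two_one halt hclosed hz hy, hq y hy]
  set N := C₂ ⊔ span k {⁅u, w⁆}
  obtain ⟨y, hy, hyN⟩ := exists_mem_one_notMem hiso hN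
  have hA := hC.sup_span_singleton halt hN hy fun s hs ↦ hNperp s hs y hy
  have hArank := finrank_sup_span_singleton hyN
  have hmem : ∀ x ∈ C₁, ω y x = 0 → x ∈ N ⊔ span k {y} := by
    intro x hx hyx
    by_contra hxA
    have h1 := hmax _ (hC.sup_span_singleton halt hA hx fun s hs ↦ by
      obtain ⟨n, hn, a, rfl⟩ := exists_add_smul_of_mem_sup_span_singleton hs
      simp [hNperp n hn x hx, hyx])
    rw [finrank_sup_span_singleton hxA] at h1
    omega
  have hAperp := finrank_add_finrank_orthogonalBilin halt hnondeg (N ⊔ span k {y})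
  have hAdim := hdim _ hA
  obtain ⟨x, hx, hxA, hex⟩ := exists_mem_notMem_apply_eq_zero
    (S := N ⊔ span k {y}) (T := (N ⊔ span k {y}).orthogonalBilin ω)
    (ω y ∘ₗ (LieAlgebra.ad k g e)) (by omega)
  have hxU : x ∈ C₂.orthogonalBilin ω := fun z hz ↦ hx z (hA.le hz)
  have h1 := hmax _ (hA.sup_span_singleton halt hx fun t ↦ by
    obtain ⟨v, hv, a, rfl⟩ := hdec t
    rw [add_lie, smul_lie]
    refine add_mem (hmem _ (hC.lie_mem_one v x) ?_)
      (smul_mem _ _ (hmem _ (hC.lie_mem_one e x) hex))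
    rw [apply_swap_of_alternating halt,
      hC.apply_lie_of_mem_orthogonal hclosed hv hxU hy, neg_zero])
  rw [finrank_sup_span_singleton hxA] at h1
  omega

/-- If isotropic ideals over a two-dimensional `C₂` have dimension at most three, and none of
them is Lagrangian, then `C₁` is isotropic. -/
theorem isIsotropicSubspace_of_finrank_eq_two [CharZero k] [FiniteDimensional k g]
    (hC : IsThreeStepSeries C₁ C₂)
    (halt : ∀ u, ω u u = 0) (hnondeg : ∀ u, (∀ v, ω u v = 0) → u = 0)
    (hclosed : ∀ u v w : g, ω ⁅u, v⁆ w + ω ⁅w, u⁆ v + ω ⁅v, w⁆ u = 0)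
    (hmax : ∀ S, IsIsotropicIdealOver ω C₂ S → finrank k S ≤ 3)
    (hdim : ∀ S, IsIsotropicIdealOver ω C₂ S → 2 * finrank k S + 2 ≤ finrank k g)
    (hrank : finrank k C₂ = 2) : IsIsotropicSubspace ω C₁ := by
  by_contra hiso
  have hC₂ := hC.isIsotropicIdealOver_self hclosed
  have hline : ∀ y ∈ C₁, IsIsotropicIdealOver ω C₂ (C₂ ⊔ span k {y}) := fun y hy ↦
    hC.sup_span_singleton halt hC₂ hy fun s hs ↦ hC.apply_two_one halt hclosed hs hy
  have hmem : ∀ y ∈ C₁, y ∉ C₂ → ∀ x ∈ C₁, ω y x = 0 → x ∈ C₂ ⊔ span k {y} := by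
    intro y hy hyC x hx hyx
    by_contra hxA
    have h1 := hmax _ (hC.sup_span_singleton halt (hline y hy) hx fun s hs ↦ by
      obtain ⟨n, hn, a, rfl⟩ := exists_add_smul_of_mem_sup_span_singleton hs
      simp [hC.apply_two_one halt hclosed hn hx, hyx])
    rw [finrank_sup_span_singleton hxA, finrank_sup_span_singleton hyC] at h1
    omega
  have hex : ∀ y ∈ C₁, y ∉ C₂ → ∃ x ∈ C₁, ω y x ≠ 0 := by
    intro y hy hyC
    by_contra! h
    obtain ⟨x, hx, hxA⟩ := exists_mem_one_notMem hiso (hline y hy)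
    exact hxA (hmem y hy hyC x hx (h x hx))
  have hU : ∀ u ∈ C₂.orthogonalBilin ω, ∀ w ∈ C₂.orthogonalBilin ω, ⁅u, w⁆ ∈ C₂ := by
    intro u hu w hw
    by_contra h
    obtain ⟨x, hx, hux⟩ := hex _ (hC.lie_mem_one u w) h
    exact hux (hC.apply_lie_of_mem_orthogonal hclosed hu hw hx)
  have hUrank := finrank_add_finrank_orthogonalBilin halt hnondeg C₂
  obtain ⟨e, -, he⟩ := exists_mem_notMem_of_finrank_lt
    (S := C₂.orthogonalBilin ω) (T := ⊤) (by rw [finrank_top]; omega)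
  have herank := finrank_sup_span_singleton he
  obtain ⟨f, -, hf⟩ := exists_mem_notMem_of_finrank_lt
    (S := C₂.orthogonalBilin ω ⊔ span k {e}) (T := ⊤) (by rw [finrank_top]; omega)
  have htop : C₂.orthogonalBilin ω ⊔ span k {e} ⊔ span k {f} = ⊤ := by
    apply eq_top_of_finrank_eq
    rw [finrank_sup_span_singleton hf]
    omega
  have hlie : ∀ S : Submodule k g, C₂ ≤ S → ∀ v ∈ C₂.orthogonalBilin ω, ⁅e, v⁆ ∈ S →
      ⁅f, v⁆ ∈ S → ∀ x : g, ⁅x, v⁆ ∈ S := by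
    intro S hS v hv hev hfv x
    obtain ⟨x', hx', b, rfl⟩ :=
      exists_add_smul_of_mem_sup_span_singleton (u := x) (htop ▸ mem_top)
    obtain ⟨u, hu, a, rfl⟩ := exists_add_smul_of_mem_sup_span_singleton hx'
    rw [add_lie, add_lie, smul_lie, smul_lie]
    exact add_mem (add_mem (hS (hU u hu v hv)) (smul_mem _ _ hev)) (smul_mem _ _ hfv)
  have hTU : ∀ v ∈ C₁.orthogonalBilin ω, v ∈ C₂.orthogonalBilin ω :=
    fun v hv z hz ↦ hv z (hC.le hz)
  have hTrank : 4 ≤ finrank k (C₁.orthogonalBilin ω) := by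
    obtain ⟨y, hy, hyC⟩ := exists_mem_one_notMem hiso hC₂
    obtain ⟨x, hx, hyx⟩ := hex y hy hyC
    have hyrank := finrank_sup_span_singleton hyC
    have hydim := hdim _ (hline y hy)
    have hxN : x ∉ C₂ ⊔ span k {y} := fun h ↦ hyx <|
      (hline y hy).isotropic y (mem_sup_right (mem_span_singleton_self y)) x h
    have hxrank := finrank_sup_span_singleton hxN
    have hle : C₁ ≤ C₂ ⊔ span k {y} ⊔ span k {x} := by
      intro t ht
      rw [← sub_add_cancel t ((ω y t / ω y x) • x)]
      refine add_mem (mem_sup_left (hmem y hy hyC _ (sub_mem ht (smul_mem _ _ hx)) ?_))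
        (mem_sup_right (smul_mem _ _ (mem_span_singleton_self x)))
      simp [hyx]
    have h1 := finrank_mono hle
    have h2 := finrank_add_finrank_orthogonalBilin halt hnondeg C₁
    omega
  obtain ⟨v, hv, hvC, hev⟩ : ∃ v ∈ C₁.orthogonalBilin ω, v ∉ C₂ ∧ ⁅e, v⁆ ∈ C₂ := by
    by_cases hall : ∀ v ∈ C₁.orthogonalBilin ω, ⁅e, v⁆ ∈ C₂
    · obtain ⟨v, hv, hvC⟩ :=
        exists_mem_notMem_of_finrank_lt (S := C₂) (T := C₁.orthogonalBilin ω) (by omega)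
      exact ⟨v, hv, hvC, hall v hv⟩
    push Not at hall
    obtain ⟨v₀, hv₀, hev₀⟩ := hall
    obtain ⟨x, hx, hyx⟩ := hex _ (hC.lie_mem_one e v₀) hev₀
    obtain ⟨v, hv, hvC, hxv⟩ := exists_mem_notMem_apply_eq_zero
      (S := C₂) (T := C₁.orthogonalBilin ω)
      (ω.flip x ∘ₗ (LieAlgebra.ad k g e)) (by omega)
    refine ⟨v, hv, hvC, ?_⟩
    obtain ⟨z, hz, a, ha⟩ := exists_add_smul_of_mem_sup_span_singleton <|
      hmem _ (hC.lie_mem_one e v₀) hev₀ _ (hC.lie_mem_one e v) <|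
        hC.apply_lie_lie_eq_zero halt hclosed (hTU _ hv₀) (hTU _ hv)
          (hU _ (hTU _ hv₀) _ (hTU _ hv)) e
    change ω ⁅e, v⁆ x = 0 at hxv
    rw [← ha] at hxv ⊢
    have ha0 : a = 0 := by simpa [hC.apply_two_one halt hclosed hz hx, hyx] using hxv
    simpa [ha0] using hz
  by_cases hfv : ⁅f, v⁆ ∈ C₂
  · have hA := hC₂.sup_span_singleton halt (hTU v hv) (hlie C₂ le_rfl v (hTU v hv) hev hfv)
    obtain ⟨y, hy, hyA⟩ := exists_mem_one_notMem hiso hA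
    have h1 := hmax _ (hC.sup_span_singleton halt hA hy fun s hs ↦ by
      obtain ⟨n, hn, a, rfl⟩ := exists_add_smul_of_mem_sup_span_singleton hs
      have hvy : ω v y = 0 := by rw [apply_swap_of_alternating halt, hv y hy, neg_zero]
      simp [hC.apply_two_one halt hclosed hn hy, hvy])
    rw [finrank_sup_span_singleton hyA, finrank_sup_span_singleton hvC] at h1
    omega
  · have hN := hline _ (hC.lie_mem_one f v)
    have hNC : C₂ ⊔ span k {⁅f, v⁆} ≤ C₁ :=
      sup_le hC.le ((span_singleton_le_iff_mem _ _).2 (hC.lie_mem_one f v))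
    have hvN : v ∉ C₂ ⊔ span k {⁅f, v⁆} := by
      intro h
      obtain ⟨x, hx, hvx⟩ := hex v (hNC h) hvC
      exact hvx (by rw [apply_swap_of_alternating halt, hv x hx, neg_zero])
    have h1 := hmax _ (hN.sup_span_singleton halt (fun s hs ↦ hv s (hNC hs)) <|
      hlie _ hN.le v (hTU v hv) (hN.le hev) (mem_sup_right (mem_span_singleton_self _)))
    rw [finrank_sup_span_singleton hvN, finrank_sup_span_singleton hfv] at h1
    omega

theorem exists_lagrangian_isIsotropicIdealOver [CharZero k] [FiniteDimensional k g]
    (hC : IsThreeStepSeries C₁ C₂)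
    (halt : ∀ u, ω u u = 0) (hnondeg : ∀ u, (∀ v, ω u v = 0) → u = 0)
    (hclosed : ∀ u v w : g, ω ⁅u, v⁆ w + ω ⁅w, u⁆ v + ω ⁅v, w⁆ u = 0)
    (hle : finrank k g ≤ 8) :
    ∃ S, IsIsotropicIdealOver ω C₂ S ∧ 2 * finrank k S = finrank k g := by
  by_cases hiso : IsIsotropicSubspace ω C₁
  · obtain ⟨L, hL, hLiso, hLrank⟩ := hiso.exists_lagrangian halt hnondeg
    exact ⟨L, ⟨hC.le.trans hL, hLiso, fun x y _ ↦ hL (hC.lie_mem_one x y)⟩, hLrank⟩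
  by_contra! hne
  have hC₂ := hC.isIsotropicIdealOver_self hclosed
  obtain ⟨L, -, -, hL⟩ := hC₂.isotropic.exists_lagrangian halt hnondeg
  have hdim : ∀ S, IsIsotropicIdealOver ω C₂ S → 2 * finrank k S + 2 ≤ finrank k g := by
    intro S hS
    have h1 := hS.isotropic.two_mul_finrank_le halt hnondeg
    have h2 := hne S hS
    omega
  have hmax : ∀ S, IsIsotropicIdealOver ω C₂ S → finrank k S ≤ 3 := by
    intro S hS
    have h1 := hdim S hS
    omega
  obtain ⟨y, hy, hyC⟩ := exists_mem_one_notMem hiso hC₂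
  have h1 := hmax _ (hC.sup_span_singleton halt hC₂ hy fun s hs ↦
    hC.apply_two_one halt hclosed hs hy)
  rw [finrank_sup_span_singleton hyC] at h1
  obtain h | h | h : finrank k C₂ = 0 ∨ finrank k C₂ = 1 ∨ finrank k C₂ = 2 := by omega
  · have hbot : C₂ = ⊥ := finrank_eq_zero.1 h
    have hmem : ∀ u : g, u ∈ C₂.orthogonalBilin ω := by
      intro u z hz
      rw [hbot, mem_bot] at hz
      simp [hz]
    refine hiso fun x hx z hz ↦ hC.one_le (LinearMap.ker (ω.flip z)) (fun u w ↦ ?_) hx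
    exact hC.apply_lie_of_mem_orthogonal hclosed (hmem u) (hmem w) hz
  · exact hiso (hC.isIsotropicSubspace_of_finrank_eq_one halt hnondeg hclosed hmax hdim h)
  · exact hiso (hC.isIsotropicSubspace_of_finrank_eq_two halt hnondeg hclosed hmax hdim h)

end IsThreeStepSeries

theorem isThreeStepSeries_lowerCentralSeries
    (h3step : LieModule.lowerCentralSeries k g g 3 = ⊥) :
    IsThreeStepSeries (LieModule.lowerCentralSeries k g g 1).toSubmodule
      (LieModule.lowerCentralSeries k g g 2).toSubmodule where
  le := LieModule.antitone_lowerCentralSeries k g g one_le_two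
  lie_mem_one x y := by
    simp only [LieModule.lowerCentralSeries_succ]
    exact LieSubmodule.lie_mem_lie (LieSubmodule.mem_top x) (LieSubmodule.mem_top y)
  one_le P hP := by
    rw [LieModule.lowerCentralSeries_succ, LieSubmodule.lieIdeal_oper_eq_linear_span',
      span_le]
    rintro _ ⟨x, -, y, -, rfl⟩
    exact hP x y
  lie_mem_two x y hy := by
    rw [LieModule.lowerCentralSeries_succ k g g 1]
    exact LieSubmodule.lie_mem_lie (LieSubmodule.mem_top x) hy
  lie_eq_zero x y hy := by
    rw [← LieSubmodule.mem_bot (R := k) (L := g), ← h3step,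
      LieModule.lowerCentralSeries_succ k g g 2]
    exact LieSubmodule.lie_mem_lie (LieSubmodule.mem_top x) hy

end SymplecticLieAlgebra

/-- Every three-step nilpotent symplectic Lie algebra (`C³g = 0`) of
dimension at most eight admits a Lagrangian ideal containing `C²g = [g, [g, g]]`. -/
theorem stmt_18 {k : Type*} [Field k] [CharZero k]
    {g : Type*} [LieRing g] [LieAlgebra k g] [Module.Finite k g]
    (ω : g →ₗ[k] g →ₗ[k] k)
    (halt : ∀ u : g, ω u u = 0)
    (hnondeg : ∀ u : g, (∀ v : g, ω u v = 0) → u = 0)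
    (hclosed : ∀ u v w : g, ω ⁅u, v⁆ w + ω ⁅w, u⁆ v + ω ⁅v, w⁆ u = 0)
    (h3step : LieModule.lowerCentralSeries k g g 3 = ⊥)
    (hdim : Module.finrank k g ≤ 8) :
    ∃ a : LieIdeal k g,
      LieModule.lowerCentralSeries k g g 2 ≤ a ∧
      (∀ x ∈ a, ∀ y ∈ a, ω x y = 0) ∧
      2 * Module.finrank k a.toSubmodule = Module.finrank k g := by
  obtain ⟨S, hS, hrank⟩ := (isThreeStepSeries_lowerCentralSeries h3step
    ).exists_lagrangian_isIsotropicIdealOver halt hnondeg hclosed hdim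
  exact ⟨{ S with lie_mem := fun {x y} hy ↦ hS.lie_mem x y hy }, hS.le, hS.isotropic, hrank⟩
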